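/- Let R be a TRS and P ⊆ DP(R) such that R ∪ P is a right-linear overlay system. Then there exists no infinite minimal (P,R)-chain if and only if there exists no infinite innermost minimal (P,R)-chain. -/

import Mathlib

namespace RWS

/-- First-order terms over a signature `F` (function symbols of arbitrary arity,
realized by lists of arguments) and variables `V`. -/
inductive Term (F V : Type) : Type
  | var : V → Term F V
  | app : F → List (Term F V) → Term F V

namespace Term

variable {F V : Type}

/-- `t` is a variable. -/
def IsVar : Term F V → Prop
  | var _ => True
  | app _ _ => False

/-- Application of a substitution (a map from variables to terms) to a term. -/
def subst (σ : V → Term F V) : Term F V → Term F V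
  | var x => σ x
  | app f ts => app f (ts.attach.map fun t => t.1.subst σ)
decreasing_by
  simp_wf
  have := List.sizeOf_lt_of_mem t.2
  omega

/-- The list of variable occurrences of a term. -/
def varOccs : Term F V → List V
  | var x => [x]
  | app _ ts => (ts.attach.map fun t => t.1.varOccs).flatten
decreasing_by
  simp_wf
  have := List.sizeOf_lt_of_mem t.2
  omega

/-- A term is linear if no variable occurs in it more than once. -/
def Linear (t : Term F V) : Prop := t.varOccs.Nodup

end Term

variable {F V : Type}

/-- `PSub t u` : `t` is a proper subterm of `u` (i.e. `u ▷ t`). -/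
inductive PSub : Term F V → Term F V → Prop
  | head {t f ts} : t ∈ ts → PSub t (.app f ts)
  | tail {t u f ts} : PSub t u → u ∈ ts → PSub t (.app f ts)

/-- Subterm-or-equal relation. -/
def Sub (t u : Term F V) : Prop := t = u ∨ PSub t u

/-- The rewrite relation of a set `R` of rewrite rules: contraction of a redex
at some position (root rule instance, closed under contexts). -/
inductive Rew (R : Set (Term F V × Term F V)) : Term F V → Term F V → Prop
  | root {l r : Term F V} {σ : V → Term F V} :
      (l, r) ∈ R → Rew R (l.subst σ) (r.subst σ)
  | congr {s t : Term F V} {f : F} {ts us : List (Term F V)} :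
      Rew R s t → Rew R (.app f (ts ++ s :: us)) (.app f (ts ++ t :: us))

/-- `t` is a normal form of `R`. -/
def NormalForm (R : Set (Term F V × Term F V)) (t : Term F V) : Prop :=
  ∀ u, ¬ Rew R t u

/-- Innermost rewriting: contraction of a redex all of whose proper subterms
are normal forms of `R`. -/
inductive IRew (R : Set (Term F V × Term F V)) : Term F V → Term F V → Prop
  | root {l r : Term F V} {σ : V → Term F V} :
      (l, r) ∈ R → (∀ u, PSub u (l.subst σ) → NormalForm R u) →
      IRew R (l.subst σ) (r.subst σ)
  | congr {s t : Term F V} {f : F} {ts us : List (Term F V)} :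
      IRew R s t → IRew R (.app f (ts ++ s :: us)) (.app f (ts ++ t :: us))

/-- A rewrite step at the root position (`→_{ε}`). -/
def RootStep (R : Set (Term F V × Term F V)) (s t : Term F V) : Prop :=
  ∃ l r σ, (l, r) ∈ R ∧ s = Term.subst σ l ∧ t = Term.subst σ r

/-- A rewrite step strictly below the root (`→_{>ε}`). -/
def BelowRew (R : Set (Term F V × Term F V)) (s t : Term F V) : Prop :=
  ∃ (f : F) (ts us : List (Term F V)) (a b : Term F V),
    Rew R a b ∧ s = .app f (ts ++ a :: us) ∧ t = .app f (ts ++ b :: us)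

/-- An innermost rewrite step strictly below the root (`i→_{>ε}`). -/
def IBelowRew (R : Set (Term F V × Term F V)) (s t : Term F V) : Prop :=
  ∃ (f : F) (ts us : List (Term F V)) (a b : Term F V),
    IRew R a b ∧ s = .app f (ts ++ a :: us) ∧ t = .app f (ts ++ b :: us)

/-- `R` is a term rewrite system: left-hand sides are not variables and
variables of right-hand sides occur in the corresponding left-hand sides. -/
def IsTRS (R : Set (Term F V × Term F V)) : Prop :=
  ∀ p ∈ R, ¬ p.1.IsVar ∧ ∀ x ∈ p.2.varOccs, x ∈ p.1.varOccs

/-- All right-hand sides are linear. -/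
def RightLinear (R : Set (Term F V × Term F V)) : Prop :=
  ∀ p ∈ R, p.2.Linear

/-- No right-hand side is a variable. -/
def NonCollapsing (R : Set (Term F V × Term F V)) : Prop :=
  ∀ p ∈ R, ¬ p.2.IsVar

/-- `R` has an inner-overlap: a proper non-variable subterm of some left-hand
side is unifiable (after renaming the rules apart, equivalently: some instance
of the one equals some instance of the other) with some left-hand side. -/
def InnerOverlap (R : Set (Term F V × Term F V)) : Prop :=
  ∃ l r l' r' u, (l, r) ∈ R ∧ (l', r') ∈ R ∧ PSub u l ∧ ¬ u.IsVar ∧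
    ∃ σ τ : V → Term F V, u.subst σ = l'.subst τ

/-- `R` is an overlay system. -/
def Overlay (R : Set (Term F V × Term F V)) : Prop := ¬ InnerOverlap R

/-- The term `t` is terminating w.r.t. `R`: no infinite rewrite sequence starts from `t`. -/
def Terminating (R : Set (Term F V × Term F V)) (t : Term F V) : Prop :=
  ¬ ∃ f : ℕ → Term F V, f 0 = t ∧ ∀ n, Rew R (f n) (f (n + 1))

/-- The TRS `R` is terminating: there is no infinite rewrite sequence. -/
def TerminatingTRS (R : Set (Term F V × Term F V)) : Prop :=
  ¬ ∃ f : ℕ → Term F V, ∀ n, Rew R (f n) (f (n + 1))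

/-- The TRS `R` is innermost terminating: there is no infinite innermost rewrite sequence. -/
def InnermostTerminatingTRS (R : Set (Term F V × Term F V)) : Prop :=
  ¬ ∃ f : ℕ → Term F V, ∀ n, IRew R (f n) (f (n + 1))

/-- Domain of a substitution. -/
def Dom (σ : V → Term F V) : Set V := {x | σ x ≠ .var x}

end RWS

namespace RWS

variable {F V : Type}

/-- Embedding of terms over the signature `F` into terms over the extended
signature `F ⊕ F`, where `Sum.inl f` is the original symbol `f` and
`Sum.inr f` is the fresh tuple symbol `f#`. -/
def Term.lift : Term F V → Term (F ⊕ F) V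
  | .var x => .var x
  | .app f ts => .app (Sum.inl f) (ts.attach.map fun t => t.1.lift)
decreasing_by
  simp_wf
  have := List.sizeOf_lt_of_mem t.2
  omega

/-- The TRS `R` viewed over the extended signature `F ⊕ F`. -/
def liftTRS (R : Set (Term F V × Term F V)) :
    Set (Term (F ⊕ F) V × Term (F ⊕ F) V) :=
  { p | ∃ l r, (l, r) ∈ R ∧ p = (l.lift, r.lift) }

/-- The defined symbols of `R`: root symbols of left-hand sides. -/
def DefinedSym (R : Set (Term F V × Term F V)) : Set F :=
  { f | ∃ ts r, (Term.app f ts, r) ∈ R }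

/-- `t#`: the term `f(t₁,…,tₙ)` with its root replaced by the tuple symbol `f#`. -/
def Term.sharp : Term F V → Term (F ⊕ F) V
  | .var x => .var x
  | .app f ts => .app (Sum.inr f) (ts.attach.map fun t => t.1.lift)

/-- The set of dependency pairs of `R`: rules `ℓ# → t#` where `ℓ → r ∈ R` and
`t` is a subterm of `r` whose root symbol is defined. -/
def DP (R : Set (Term F V × Term F V)) :
    Set (Term (F ⊕ F) V × Term (F ⊕ F) V) :=
  { p | ∃ l r t, (l, r) ∈ R ∧ Sub t r ∧
        (∃ g ts, t = Term.app g ts ∧ g ∈ DefinedSym R) ∧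
        p = (l.sharp, t.sharp) }

/-- There is an infinite minimal `(P,R)`-chain
`t₀ →_{>ε,R}* s₀ →_{ε,P} t₁ →_{>ε,R}* s₁ →_{ε,P} t₂ ⋯` (all proper subterms of
the `tᵢ` are terminating w.r.t. `R`). -/
def InfMinChain (P R : Set (Term F V × Term F V)) : Prop :=
  ∃ t s : ℕ → Term F V,
    (∀ i, Relation.ReflTransGen (BelowRew R) (t i) (s i)) ∧
    (∀ i, RootStep P (s i) (t (i + 1))) ∧
    (∀ i v, PSub v (t i) → Terminating R v)

/-- There is an infinite innermost minimal `(P,R)`-chain: as above, where the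
below-root `R`-steps are innermost and each root `P`-step is applied to a term
all of whose proper subterms are normal forms of `R`. -/
def InfInnMinChain (P R : Set (Term F V × Term F V)) : Prop :=
  ∃ t s : ℕ → Term F V,
    (∀ i, Relation.ReflTransGen (IBelowRew R) (t i) (s i)) ∧
    (∀ i v, PSub v (s i) → NormalForm R v) ∧
    (∀ i, RootStep P (s i) (t (i + 1))) ∧
    (∀ i v, PSub v (t i) → Terminating R v)

/-- Finite minimal `(P,R)`-chains of length `n` (number of root `P`-steps),
from the first term to the term reached right after the `n`-th root `P`-step. -/
inductive MinChainN (P R : Set (Term F V × Term F V)) :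
    ℕ → Term F V → Term F V → Prop
  | refl {t : Term F V} :
      (∀ v, PSub v t → Terminating R v) → MinChainN P R 0 t t
  | step {n : ℕ} {t₀ t s t' : Term F V} :
      MinChainN P R n t₀ t →
      Relation.ReflTransGen (BelowRew R) t s →
      RootStep P s t' →
      (∀ v, PSub v t' → Terminating R v) →
      MinChainN P R (n + 1) t₀ t'

/-- Finite innermost minimal `(P,R)`-chains of length `n`. -/
inductive InnMinChainN (P R : Set (Term F V × Term F V)) :
    ℕ → Term F V → Term F V → Prop
  | refl {t : Term F V} :
      (∀ v, PSub v t → Terminating R v) → InnMinChainN P R 0 t t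
  | step {n : ℕ} {t₀ t s t' : Term F V} :
      InnMinChainN P R n t₀ t →
      Relation.ReflTransGen (IBelowRew R) t s →
      (∀ v, PSub v s → NormalForm R v) →
      RootStep P s t' →
      (∀ v, PSub v t' → Terminating R v) →
      InnMinChainN P R (n + 1) t₀ t'

end RWS

namespace RWS

open Relation Function

theorem append_cons_eq_append_cons {α : Type*} {ts us pre post : List α} {s a : α}
    (h : ts ++ s :: us = pre ++ a :: post) :
    (ts = pre ∧ s = a ∧ us = post) ∨
    (∃ mid, pre = ts ++ s :: mid ∧ us = mid ++ a :: post) ∨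
    (∃ mid, ts = pre ++ a :: mid ∧ post = mid ++ s :: us) := by
  induction ts generalizing pre with
  | nil =>
    cases pre with
    | nil => simp_all
    | cons p pre => simp_all
  | cons x ts ih =>
    cases pre with
    | nil => simp_all
    | cons p pre =>
      simp only [List.cons_append, List.cons.injEq] at h
      rcases ih h.2 with ⟨h1, h2, h3⟩ | ⟨mid, h1, h2⟩ | ⟨mid, h1, h2⟩ <;> simp_all

variable {F V : Type}

namespace Term

theorem induction_on_args {motive : Term F V → Prop} (var : ∀ x, motive (.var x))
    (app : ∀ f ts, (∀ t ∈ ts, motive t) → motive (.app f ts)) : ∀ t, motive t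
  | .var x => var x
  | .app f ts => app f ts fun t _ => induction_on_args var app t

@[simp] theorem subst_var (σ : V → Term F V) (x : V) : (var x : Term F V).subst σ = σ x := by
  rw [subst]

@[simp] theorem subst_app (σ : V → Term F V) (f : F) (ts : List (Term F V)) :
    (app f ts).subst σ = app f (ts.map (subst σ)) := by
  rw [subst]; simp

@[simp] theorem varOccs_var (x : V) : (var x : Term F V).varOccs = [x] := by
  rw [varOccs]

@[simp] theorem varOccs_app (f : F) (ts : List (Term F V)) :
    (app f ts).varOccs = (ts.map varOccs).flatten := by
  rw [varOccs]; simp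

theorem subst_congr {σ τ : V → Term F V} (t : Term F V) (h : ∀ x ∈ t.varOccs, σ x = τ x) :
    t.subst σ = t.subst τ := by
  induction t using induction_on_args with
  | var x => simpa using h
  | app f ts ih =>
    simp only [subst_app, app.injEq, List.map_inj_left, true_and]
    intro t ht
    refine ih t ht fun x hx => h x ?_
    simp only [varOccs_app, List.mem_flatten, List.mem_map]
    exact ⟨_, ⟨t, ht, rfl⟩, hx⟩

end Term

theorem psub_app_iff {t : Term F V} {f : F} {ts : List (Term F V)} :
    PSub t (.app f ts) ↔ ∃ s ∈ ts, Sub t s := by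
  constructor
  · rintro (h | ⟨h, h'⟩)
    · exact ⟨t, h, Or.inl rfl⟩
    · exact ⟨_, h', Or.inr h⟩
  · rintro ⟨s, hs, rfl | h⟩
    · exact .head hs
    · exact .tail h hs

theorem not_psub_var {t : Term F V} {x : V} : ¬ PSub t (.var x) := nofun

theorem PSub.trans {s t u : Term F V} (h : PSub s t) (h' : PSub t u) : PSub s u := by
  induction h' with
  | head hm => exact .tail h hm
  | tail _ hm ih => exact .tail ih hm

theorem sub_var_of_mem {x : V} {t : Term F V} (h : x ∈ t.varOccs) : Sub (.var x) t := by
  induction t using Term.induction_on_args with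
  | var y => simp_all [Sub]
  | app f ts ih =>
    simp only [Term.varOccs_app, List.mem_flatten, List.mem_map] at h
    obtain ⟨_, ⟨t, ht, rfl⟩, hx⟩ := h
    exact .inr (psub_app_iff.2 ⟨t, ht, ih t ht hx⟩)

theorem PSub.subst {s t : Term F V} (h : PSub s t) (σ : V → Term F V) :
    PSub (s.subst σ) (t.subst σ) := by
  induction h with
  | head hm => rw [Term.subst_app]; exact .head (List.mem_map_of_mem hm)
  | tail _ hm ih => rw [Term.subst_app]; exact .tail ih (List.mem_map_of_mem hm)

theorem psub_subst_of_mem {x : V} {t : Term F V} (hx : x ∈ t.varOccs) (ht : ¬ t.IsVar)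
    (σ : V → Term F V) : PSub (σ x) (t.subst σ) := by
  rcases sub_var_of_mem hx with rfl | h
  · exact absurd trivial ht
  · simpa using h.subst σ

/-- One-hole contexts. -/
inductive Ctx (F V : Type) : Type
  | hole : Ctx F V
  | app : F → List (Term F V) → Ctx F V → List (Term F V) → Ctx F V

namespace Ctx

/-- Plugging a term into the hole of a context. -/
def fill : Ctx F V → Term F V → Term F V
  | hole, t => t
  | app f pre C post, t => .app f (pre ++ C.fill t :: post)

/-- Composition of contexts. -/
def comp : Ctx F V → Ctx F V → Ctx F V
  | hole, D => D
  | app f pre C post, D => app f pre (C.comp D) post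

@[simp] theorem fill_hole (t : Term F V) : (hole : Ctx F V).fill t = t := rfl

@[simp] theorem fill_app (f : F) (pre post : List (Term F V)) (C : Ctx F V) (t : Term F V) :
    (app f pre C post).fill t = .app f (pre ++ C.fill t :: post) := rfl

@[simp] theorem fill_comp (C D : Ctx F V) (t : Term F V) :
    (C.comp D).fill t = C.fill (D.fill t) := by
  induction C with
  | hole => rfl
  | app f pre C post ih => simp [comp, ih]

theorem comp_ne_hole {C D : Ctx F V} (h : C ≠ hole ∨ D ≠ hole) : C.comp D ≠ hole := by
  cases C <;> simp_all [comp]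

end Ctx

open Classical in
/-- Up to the value of a variable `x` occurring in a linear term `r`, the instance `rσ` is a
context. -/
theorem exists_ctx_of_linear (σ : V → Term F V) {x : V} {r : Term F V} (hr : r.Linear)
    (hx : x ∈ r.varOccs) :
    ∃ C : Ctx F V, (¬ r.IsVar → C ≠ .hole) ∧ ∀ v, r.subst (update σ x v) = C.fill v := by
  induction r using Term.induction_on_args with
  | var y =>
    obtain rfl : x = y := by simpa using hx
    exact ⟨.hole, fun h => absurd trivial h, by simp⟩
  | app f ts ih =>
    simp only [Term.varOccs_app, List.mem_flatten, List.mem_map] at hx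
    obtain ⟨_, ⟨t, ht, rfl⟩, hx⟩ := hx
    simp only [Term.Linear, Term.varOccs_app] at hr
    obtain ⟨pre, post, rfl⟩ := List.append_of_mem ht
    simp only [List.map_append, List.map_cons, List.flatten_append, List.flatten_cons,
      List.nodup_append, List.mem_append] at hr
    obtain ⟨C, -, hC⟩ := ih t ht hr.2.1.1 hx
    refine ⟨.app f (pre.map (Term.subst σ)) C (post.map (Term.subst σ)), by simp, fun v => ?_⟩
    have aux : ∀ s : Term F V, x ∉ s.varOccs → s.subst (update σ x v) = s.subst σ := fun s hs =>
      Term.subst_congr s fun y hy => update_of_ne (by rintro rfl; exact hs hy) _ _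
    simp only [Term.subst_app, List.map_append, List.map_cons, hC, Ctx.fill_app,
      Term.app.injEq, true_and]
    congr 1
    · refine List.map_congr_left fun s hs => aux s fun h => ?_
      exact hr.2.2 x (List.mem_flatten.2 ⟨_, List.mem_map_of_mem hs, h⟩) x (.inl hx) rfl
    · congr 1
      refine List.map_congr_left fun s hs => aux s fun h => ?_
      exact hr.2.1.2.2 x hx x (List.mem_flatten.2 ⟨_, List.mem_map_of_mem hs, h⟩) rfl

variable {R : Set (Term F V × Term F V)}

theorem Rew.fill {a b : Term F V} (h : Rew R a b) (C : Ctx F V) :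
    Rew R (C.fill a) (C.fill b) := by
  induction C with
  | hole => exact h
  | app f pre C post ih => exact .congr ih

/-- Many-step rewriting. -/
abbrev Reds (R : Set (Term F V × Term F V)) : Term F V → Term F V → Prop :=
  ReflTransGen (Rew R)

theorem reds_fill {a b : Term F V} (h : Reds R a b) (C : Ctx F V) :
    Reds R (C.fill a) (C.fill b) :=
  h.lift C.fill fun _ _ h => h.fill C

/-- Closing a relation under contexts argumentwise. -/
theorem reflTransGen_app_of_forall₂ {r r' : Term F V → Term F V → Prop} {f : F}
    (h : ∀ {s t : Term F V} {ts us : List (Term F V)}, r s t →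
      r' (.app f (ts ++ s :: us)) (.app f (ts ++ t :: us)))
    {ts us : List (Term F V)} (hs : List.Forall₂ (ReflTransGen r) ts us) :
    ReflTransGen r' (.app f ts) (.app f us) := by
  suffices ∀ pre, ReflTransGen r' (.app f (pre ++ ts)) (.app f (pre ++ us)) from this []
  induction hs with
  | nil => exact fun _ => .refl
  | @cons a b ts us hab _ ih =>
    intro pre
    refine .trans (b := .app f (pre ++ b :: ts)) ?_ (by simpa using ih (pre ++ [b]))
    exact hab.lift (fun a => Term.app f (pre ++ a :: ts)) fun _ _ h' => h h'

theorem reds_app {f : F} {ts us : List (Term F V)} (h : List.Forall₂ (Reds R) ts us) :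
    Reds R (.app f ts) (.app f us) :=
  reflTransGen_app_of_forall₂ .congr h

theorem forall₂_map_subst {r : Term F V → Term F V → Prop} {σ τ : V → Term F V}
    {ts : List (Term F V)} (h : ∀ t ∈ ts, r (t.subst σ) (t.subst τ)) :
    List.Forall₂ r (ts.map (Term.subst σ)) (ts.map (Term.subst τ)) := by
  simpa [List.forall₂_map_left_iff, List.forall₂_map_right_iff, List.forall₂_same] using h

theorem reds_subst {σ τ : V → Term F V} (h : ∀ x, Reds R (σ x) (τ x)) (t : Term F V) :
    Reds R (t.subst σ) (t.subst τ) := by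
  induction t using Term.induction_on_args with
  | var x => simpa using h x
  | app f ts ih =>
    rw [Term.subst_app, Term.subst_app]
    exact reds_app (forall₂_map_subst ih)

open Classical in
theorem reds_update {σ : V → Term F V} {x : V} {v : Term F V} (h : Reds R (σ x) v) (y : V) :
    Reds R (σ y) (update σ x v y) := by
  rcases eq_or_ne y x with rfl | hy
  · simpa using h
  · rw [update_of_ne hy]

open Classical in
/-- A subterm `u` of an instance `lσ` is either an instance of a non-variable subterm of `l` or
lies inside the value of a variable; changing `u` accordingly leads to an instance of `l`. -/
theorem subst_eq_fill {σ : V → Term F V} {u : Term F V} (C : Ctx F V) :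
    ∀ l : Term F V, l.subst σ = C.fill u →
    (∃ p, (C = .hole ∧ p = l ∨ PSub p l) ∧ ¬ p.IsVar ∧ u = p.subst σ ∧
      ∀ τ, (∀ x, Reds R (σ x) (τ x)) → Reds R (C.fill (p.subst τ)) (l.subst τ)) ∨
    (∃ x D, σ x = Ctx.fill D u ∧ ∀ v, Reds R u v →
      Reds R (C.fill v) (l.subst (update σ x (D.fill v)))) := by
  induction C with
  | hole =>
    intro l hl
    cases l with
    | var x => exact .inr ⟨x, .hole, by simpa using hl, fun v _ => by simp; rfl⟩
    | app f ts => exact .inl ⟨_, .inl ⟨rfl, rfl⟩, id, hl.symm, fun τ _ => .refl⟩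
  | app f pre C post ih =>
    intro l hl
    cases l with
    | var x =>
      exact .inr ⟨x, .app f pre C post, by simpa using hl, fun v _ => by simp; rfl⟩
    | app g ls =>
      simp only [Term.subst_app, Ctx.fill_app, Term.app.injEq, List.map_eq_append_iff,
        List.map_eq_cons_iff] at hl
      obtain ⟨rfl, l₁, _, rfl, rfl, m, l₂, rfl, hm, rfl⟩ := hl
      have aux : ∀ {τ : V → Term F V} {a : Term F V}, (∀ x, Reds R (σ x) (τ x)) →
          Reds R a (m.subst τ) →
          Reds R (.app g (l₁.map (Term.subst σ) ++ a :: l₂.map (Term.subst σ)))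
            ((Term.app g (l₁ ++ m :: l₂)).subst τ) := by
        intro τ a hτ ha
        rw [Term.subst_app, List.map_append, List.map_cons]
        exact reds_app (List.rel_append (forall₂_map_subst fun t _ => reds_subst hτ t)
          (.cons ha (forall₂_map_subst fun t _ => reds_subst hτ t)))
      rcases ih m hm with ⟨p, hp, hpv, hu, h⟩ | ⟨x, D, hx, h⟩
      · refine .inl ⟨p, .inr (psub_app_iff.2 ⟨m, by simp, ?_⟩), hpv, hu, fun τ hτ => ?_⟩
        · exact hp.imp And.right id
        · exact aux hτ (h τ hτ)
      · refine .inr ⟨x, D, hx, fun v hv => aux (fun y => reds_update ?_ y) (h v hv)⟩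
        rw [hx]; exact reds_fill hv D

open Classical in
/-- Contracting a root redex that contains `u` as a proper subterm: `u` is deleted, or moved, or
overlapped by the left-hand side. -/
theorem root_contraction_cases {σ : V → Term F V} {u l r : Term F V} {C : Ctx F V}
    (hC : C ≠ .hole) (hr : r.Linear) (h : l.subst σ = C.fill u) :
    (∀ v, Reds R u v → ∃ τ, Reds R (C.fill v) (l.subst τ) ∧ r.subst σ = r.subst τ) ∨
    (∃ D : Ctx F V, (¬ r.IsVar → D ≠ .hole) ∧ r.subst σ = D.fill u ∧
      ∀ v, Reds R u v → ∃ τ, Reds R (C.fill v) (l.subst τ) ∧ D.fill v = r.subst τ) ∨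
    (∃ p, PSub p l ∧ ¬ p.IsVar ∧ u = p.subst σ ∧
      ∀ τ, (∀ x, Reds R (σ x) (τ x)) → Reds R (C.fill (p.subst τ)) (l.subst τ)) := by
  rcases subst_eq_fill (R := R) C l h with ⟨p, hp, hpv, hu, h⟩ | ⟨x, E, hx, h⟩
  · exact .inr (.inr ⟨p, hp.resolve_left (fun h => hC h.1), hpv, hu, h⟩)
  · by_cases hxr : x ∈ r.varOccs
    · obtain ⟨D, hD, hrD⟩ := exists_ctx_of_linear σ hr hxr
      refine .inr (.inl ⟨D.comp E, fun h => Ctx.comp_ne_hole (.inl (hD h)), ?_,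
        fun v hv => ⟨_, h v hv, ?_⟩⟩)
      · rw [Ctx.fill_comp, ← hx, ← hrD, update_eq_self]
      · rw [Ctx.fill_comp, hrD]
    · refine .inl fun v hv => ⟨_, h v hv, Term.subst_congr r fun y hy => ?_⟩
      rw [update_of_ne]
      rintro rfl
      exact hxr hy

/-- The possible effects on a subterm `u` of a rewrite step in a context around `u`. -/
theorem rew_fill_cases (hR : RightLinear R) {u a b : Term F V} {C : Ctx F V} (h : Rew R a b)
    (ha : a = C.fill u) :
    (∃ v, Rew R u v ∧ b = C.fill v) ∨
    (∀ v, Reds R u v → Reds R (C.fill v) b) ∨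
    (∃ D : Ctx F V, (C ≠ .hole → ¬ RootStep R a b → D ≠ .hole) ∧ b = D.fill u ∧
      ∀ v, Reds R u v → Reds R (C.fill v) (D.fill v)) ∨
    (∃ l r p σ, ∃ D : Ctx F V, (l, r) ∈ R ∧ PSub p l ∧ ¬ p.IsVar ∧ u = p.subst σ ∧
      (C ≠ .hole → ¬ RootStep R a b → D ≠ .hole) ∧ b = D.fill (r.subst σ) ∧
      ∀ τ, (∀ x, Reds R (σ x) (τ x)) → Reds R (C.fill (p.subst τ)) (D.fill (r.subst τ))) := by
  induction h generalizing C with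
  | @root l r σ hlr =>
    by_cases hC : C = .hole
    · subst hC
      exact .inl ⟨_, by rw [← Ctx.fill_hole u, ← ha]; exact .root hlr, rfl⟩
    have hroot : RootStep R (l.subst σ) (r.subst σ) := ⟨l, r, σ, hlr, rfl, rfl⟩
    have hstep : ∀ τ : V → Term F V, Rew R (l.subst τ) (r.subst τ) := fun τ => .root hlr
    rcases root_contraction_cases (R := R) hC (hR _ hlr) ha with
      h | ⟨D, -, hb, h⟩ | ⟨p, hp, hpv, hu, h⟩
    · refine .inr (.inl fun v hv => ?_)
      obtain ⟨τ, h1, h2⟩ := h v hv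
      exact h2 ▸ h1.tail (hstep τ)
    · refine .inr (.inr (.inl ⟨D, fun _ h => absurd hroot h, hb, fun v hv => ?_⟩))
      obtain ⟨τ, h1, h2⟩ := h v hv
      exact h2 ▸ h1.tail (hstep τ)
    · exact .inr (.inr (.inr ⟨l, r, p, σ, .hole, hlr, hp, hpv, hu, fun _ h => absurd hroot h, rfl,
        fun τ hτ => (h τ hτ).tail (hstep τ)⟩))
  | @congr s t f ts us hst ih =>
    cases C with
    | hole => exact .inl ⟨_, by rw [← Ctx.fill_hole u, ← ha]; exact .congr hst, rfl⟩
    | app g pre C post =>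
      simp only [Ctx.fill_app, Term.app.injEq] at ha
      obtain ⟨rfl, ha⟩ := ha
      have wrap : ∀ {a b : Term F V}, Reds R a b →
          Reds R (.app f (pre ++ a :: post)) (.app f (pre ++ b :: post)) :=
        fun h => reds_fill h (.app f pre .hole post)
      rcases append_cons_eq_append_cons ha with
        ⟨rfl, rfl, rfl⟩ | ⟨mid, rfl, rfl⟩ | ⟨mid, rfl, rfl⟩
      · rcases ih rfl with ⟨v, hv, rfl⟩ | h | ⟨D, -, rfl, h⟩ |
          ⟨l, r, p, σ, D, hlr, hp, hpv, hu, -, rfl, h⟩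
        · exact .inl ⟨v, hv, rfl⟩
        · exact .inr (.inl fun v hv => wrap (h v hv))
        · exact .inr (.inr (.inl ⟨.app f ts D us, by simp, rfl, fun v hv => wrap (h v hv)⟩))
        · exact .inr (.inr (.inr ⟨l, r, p, σ, .app f ts D us, hlr, hp, hpv, hu, by simp, rfl,
            fun τ hτ => wrap (h τ hτ)⟩))
      · refine .inr (.inr (.inl ⟨.app f (ts ++ t :: mid) C post, by simp, by simp,
          fun v _ => .single ?_⟩))
        simpa using hst.fill (.app f ts .hole (mid ++ C.fill v :: post))
      · refine .inr (.inr (.inl ⟨.app f pre C (mid ++ t :: us), by simp, by simp,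
          fun v _ => .single ?_⟩))
        simpa using hst.fill (.app f (pre ++ C.fill v :: mid) .hole us)

/-- The property `Q` of terms is preserved when the subterm `u` in a context is replaced by a
suitable normal form of `u`; if `nh` holds, only contexts other than the hole are considered. -/
def Normalizable (R : Set (Term F V × Term F V)) (Q : Term F V → Prop) (nh : Prop)
    (u : Term F V) : Prop :=
  ∀ C : Ctx F V, (nh → C ≠ .hole) → Q (C.fill u) →
    ∃ v, Reds R u v ∧ NormalForm R v ∧ Q (C.fill v)

open Classical in
theorem exists_normal_subst {Q : Term F V → Prop} {nh : Prop} {σ : V → Term F V} {r : Term F V}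
    (hr : r.Linear) {D : Ctx F V} (hD : nh → D ≠ .hole ∨ ¬ r.IsVar) (L : List V)
    (hWN : ∀ x ∈ L, ∃ v, Reds R (σ x) v ∧ NormalForm R v)
    (hL : ∀ x ∈ L, Normalizable R Q nh (σ x)) (hQ : Q (D.fill (r.subst σ))) :
    ∃ τ, (∀ x, Reds R (σ x) (τ x)) ∧ (∀ x ∈ L, NormalForm R (τ x)) ∧ (∀ x ∉ L, τ x = σ x) ∧
      Q (D.fill (r.subst τ)) := by
  induction L with
  | nil => exact ⟨σ, fun _ => .refl, by simp, by simp, hQ⟩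
  | cons x L ih =>
    obtain ⟨τ, h1, h2, h3, h4⟩ := ih (fun y hy => hWN y (.tail _ hy)) (fun y hy => hL y (.tail _ hy))
    by_cases hxL : x ∈ L
    · exact ⟨τ, h1, by simp_all, fun y hy => h3 y fun h => hy (.tail _ h), h4⟩
    obtain ⟨v, hv, hvn, hvQ⟩ : ∃ v, Reds R (σ x) v ∧ NormalForm R v ∧
        Q (D.fill (r.subst (update τ x v))) := by
      by_cases hxr : x ∈ r.varOccs
      · obtain ⟨E, hE, hrE⟩ := exists_ctx_of_linear τ hr hxr
        have := hL x (.head _) (D.comp E)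
          (fun h => Ctx.comp_ne_hole ((hD h).imp_right hE))
          (by rwa [Ctx.fill_comp, ← hrE, ← h3 x hxL, update_eq_self])
        simpa [hrE] using this
      · obtain ⟨v, hv, hvn⟩ := hWN x (.head _)
        refine ⟨v, hv, hvn, ?_⟩
        rwa [Term.subst_congr r (τ := τ) fun y hy =>
          update_of_ne (ne_of_mem_of_not_mem hy hxr) _ _]
    refine ⟨update τ x v, fun y => ?_, fun y hy => ?_, fun y hy => ?_, hvQ⟩ <;>
      rcases eq_or_ne y x with rfl | hyx
    · simpa using hv
    · simpa [hyx] using h1 y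
    · simpa using hvn
    · simpa [hyx] using h2 y (by simpa [hyx] using hy)
    · simp at hy
    · simpa [hyx] using h3 y fun h => hy (.tail _ h)

/-- Rewriting and taking proper subterms, as a descending relation. -/
def Lower (R : Set (Term F V × Term F V)) (t s : Term F V) : Prop := Rew R s t ∨ PSub t s

theorem sub_fill (t : Term F V) (C : Ctx F V) : Sub t (C.fill t) := by
  induction C with
  | hole => exact .inl rfl
  | app f pre C post ih => exact .inr (psub_app_iff.2 ⟨_, by simp, ih⟩)

theorem acc_lower_of_sub {s t : Term F V} (h : Acc (Lower R) t) (hs : Sub s t) :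
    Acc (Lower R) s := by
  rcases hs with rfl | hs
  · exact h
  · exact h.inv (.inr hs)

theorem acc_lower_of_acc {t : Term F V} (h : Acc (fun b a => Rew R a b) t) : Acc (Lower R) t := by
  induction h with
  | intro t _ ih =>
    suffices ∀ s, ∀ C : Ctx F V, t = C.fill s → Acc (Lower R) s from this t .hole rfl
    intro s
    induction s using Term.induction_on_args with
    | var x =>
      rintro C rfl
      refine ⟨_, fun v hv => hv.elim (fun hv => ?_) fun hv => absurd hv not_psub_var⟩
      exact acc_lower_of_sub (ih _ (hv.fill C)) (sub_fill v C)
    | app f ts ihs =>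
      rintro C rfl
      refine ⟨_, fun v hv => hv.elim (fun hv => ?_) fun hv => ?_⟩
      · exact acc_lower_of_sub (ih _ (hv.fill C)) (sub_fill v C)
      · obtain ⟨s, hs, hvs⟩ := psub_app_iff.1 hv
        obtain ⟨pre, post, rfl⟩ := List.append_of_mem hs
        exact acc_lower_of_sub (ihs s hs (C.comp (.app f pre .hole post)) (by simp)) hvs

theorem terminating_iff_acc {t : Term F V} : Terminating R t ↔ Acc (Lower R) t := by
  have : Terminating R t ↔ Acc (fun b a => Rew R a b) t := by
    rw [acc_iff_isEmpty_descending_chain, Terminating, isEmpty_subtype, not_exists]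
  rw [this]
  exact ⟨acc_lower_of_acc, fun h => Subrelation.accessible (fun h => Or.inl h) h⟩

theorem acc_lower_of_reds {s t : Term F V} (h : Acc (Lower R) s) (hst : Reds R s t) :
    Acc (Lower R) t := by
  induction hst with
  | refl => exact h
  | tail _ hbc ih => exact ih.inv (.inl hbc)

theorem exists_normalForm {t : Term F V} (h : Acc (Lower R) t) :
    ∃ v, Reds R t v ∧ NormalForm R v := by
  induction h with
  | intro t _ ih =>
    by_cases ht : NormalForm R t
    · exact ⟨t, .refl, ht⟩
    · obtain ⟨u, hu⟩ := not_forall_not.1 ht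
      obtain ⟨v, hv, hvn⟩ := ih u (.inl hu)
      exact ⟨v, .head hu hv, hvn⟩

theorem NormalForm.of_fill {t : Term F V} {C : Ctx F V} (h : NormalForm R (C.fill t)) :
    NormalForm R t := fun _ hu => h _ (hu.fill C)

theorem NormalForm.of_psub {s t : Term F V} (h : NormalForm R t) (hs : PSub s t) :
    NormalForm R s := by
  induction hs with
  | head hm =>
    obtain ⟨pre, post, rfl⟩ := List.append_of_mem hm
    exact .of_fill (C := .app _ pre .hole post) h
  | tail _ hm ih =>
    obtain ⟨pre, post, rfl⟩ := List.append_of_mem hm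
    exact ih (.of_fill (C := .app _ pre .hole post) h)

/-- No proper non-variable subterm of `l` is unifiable with a left-hand side of `R`. -/
def NoInnerOverlap (R : Set (Term F V × Term F V)) (l : Term F V) : Prop :=
  ∀ q, PSub q l → ¬ q.IsVar → ∀ l' r' σ τ, (l', r') ∈ R → q.subst σ ≠ Term.subst τ l'

theorem normalForm_subst_of_psub {l : Term F V} (hl : NoInnerOverlap R l) {τ : V → Term F V}
    (p : Term F V) (hp : PSub p l) (hτ : ∀ x ∈ p.varOccs, NormalForm R (τ x)) :
    NormalForm R (p.subst τ) := by
  induction p using Term.induction_on_args with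
  | var x => simpa using hτ
  | app f ts ih =>
    intro u hu
    generalize ha : (Term.app f ts).subst τ = a at hu
    cases hu with
    | root hlr => exact hl _ hp id _ _ _ _ hlr ha
    | @congr s t g pre post hst =>
      simp only [Term.subst_app, Term.app.injEq] at ha
      have hs : s ∈ ts.map (Term.subst τ) := by simp [ha.2]
      obtain ⟨q, hq, rfl⟩ := List.mem_map.1 hs
      refine ih q hq ((PSub.head hq).trans hp) (fun x hx => hτ x ?_) _ hst
      simp only [Term.varOccs_app, List.mem_flatten, List.mem_map]
      exact ⟨_, ⟨q, hq, rfl⟩, hx⟩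

theorem normalForm_args {l : Term F V} (hl : NoInnerOverlap R l) (hlv : ¬ l.IsVar)
    {τ : V → Term F V} (hτ : ∀ x ∈ l.varOccs, NormalForm R (τ x)) {u : Term F V}
    (hu : PSub u (l.subst τ)) : NormalForm R u := by
  cases l with
  | var x => exact absurd trivial hlv
  | app f ts =>
    rw [Term.subst_app] at hu
    obtain ⟨s, hs, hus⟩ := psub_app_iff.1 hu
    obtain ⟨q, hq, rfl⟩ := List.mem_map.1 hs
    have := normalForm_subst_of_psub hl q (.head hq) (τ := τ) fun x hx => hτ x <| by
      simp only [Term.varOccs_app, List.mem_flatten, List.mem_map]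
      exact ⟨_, ⟨q, hq, rfl⟩, hx⟩
    rcases hus with rfl | hus
    · exact this
    · exact this.of_psub hus

/-- When `u = pσ` is overlapped by a rule application that yields `D[rσ]`, a normal form of `u`
can be found by normalizing the values of the variables of `p`. -/
theorem exists_normalForm_of_overlap {Q : Term F V → Prop} {nh : Prop} {σ : V → Term F V}
    {l r p : Term F V} {D : Ctx F V} (hr : r.Linear) (hl : NoInnerOverlap R l) (hp : PSub p l)
    (hpv : ¬ p.IsVar) (hD : nh → D ≠ .hole ∨ ¬ r.IsVar) (hacc : Acc (Lower R) (p.subst σ))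
    (ih : ∀ v, Lower R v (p.subst σ) → Normalizable R Q nh v) (hQ : Q (D.fill (r.subst σ))) :
    ∃ τ, (∀ x, Reds R (σ x) (τ x)) ∧ Reds R (p.subst σ) (p.subst τ) ∧
      NormalForm R (p.subst τ) ∧ Q (D.fill (r.subst τ)) := by
  have hlow : ∀ x ∈ p.varOccs, Lower R (σ x) (p.subst σ) := fun x hx =>
    .inr (psub_subst_of_mem hx hpv σ)
  obtain ⟨τ, h1, h2, -, h4⟩ := exists_normal_subst hr hD p.varOccs
    (fun x hx => exists_normalForm (hacc.inv (hlow x hx))) (fun x hx => ih _ (hlow x hx)) hQ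
  exact ⟨τ, h1, reds_subst h1 p, normalForm_subst_of_psub hl p hp h2, h4⟩

theorem normalizable_reds (hR : RightLinear R) (hov : ∀ p ∈ R, NoInnerOverlap R p.1)
    {w : Term F V} (hw : NormalForm R w) {u : Term F V} (hu : Acc (Lower R) u) :
    Normalizable R (fun t => Reds R t w) False u := by
  induction hu with
  | intro u hacc ih =>
    intro C _ hC
    generalize ha : C.fill u = a at hC
    induction hC using ReflTransGen.head_induction_on generalizing C with
    | refl => exact ⟨u, .refl, .of_fill (C := C) (ha ▸ hw), ha ▸ .refl⟩
    | head hstep hrest ihC =>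
      rcases rew_fill_cases hR hstep ha.symm with ⟨v, hv, rfl⟩ | h | ⟨D, -, rfl, h⟩ |
          ⟨l, r, p, σ, D, hlr, hp, hpv, rfl, -, rfl, h⟩
      · obtain ⟨v', h1, h2, h3⟩ := ih v (.inl hv) C False.elim hrest
        exact ⟨v', .head hv h1, h2, h3⟩
      · obtain ⟨v, hv, hvn⟩ := exists_normalForm ⟨u, hacc⟩
        exact ⟨v, hv, hvn, (h v hv).trans hrest⟩
      · obtain ⟨v, hv, hvn, hvD⟩ := ihC D False.elim rfl
        exact ⟨v, hv, hvn, (h v hv).trans hvD⟩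
      · obtain ⟨τ, h1, h2, h3, h4⟩ := exists_normalForm_of_overlap
          (Q := fun t => Reds R t w) (hR _ hlr) (hov _ hlr) hp hpv False.elim ⟨_, hacc⟩ ih hrest
        exact ⟨_, h2, h3, (h τ h1).trans h4⟩

theorem forall₂_head {s t : Term F V} {pre post us : List (Term F V)} (hst : Rew R s t)
    (h : List.Forall₂ (Reds R) (pre ++ t :: post) us) :
    List.Forall₂ (Reds R) (pre ++ s :: post) us := by
  induction pre generalizing us with
  | nil =>
    cases h with
    | cons h₁ h₂ => exact .cons (.head hst h₁) h₂
  | cons a pre ih =>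
    cases h with
    | cons h₁ h₂ => exact .cons h₁ (ih h₂)

theorem forall₂_reds_trans {ts us vs : List (Term F V)} (h : List.Forall₂ (Reds R) ts us)
    (h' : List.Forall₂ (Reds R) us vs) : List.Forall₂ (Reds R) ts vs := by
  induction h generalizing vs with
  | nil => exact h'
  | cons hab _ ih =>
    cases h' with
    | cons h₁ h₂ => exact .cons (hab.trans h₁) (ih h₂)

theorem app_reds_cases {f : F} {ts : List (Term F V)} {a w : Term F V} (h : Reds R a w)
    (ha : a = .app f ts) :
    ∃ us, List.Forall₂ (Reds R) ts us ∧
      (w = .app f us ∨ ∃ b, RootStep R (.app f us) b ∧ Reds R b w) := by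
  induction h using ReflTransGen.head_induction_on generalizing ts with
  | refl => exact ⟨ts, List.forall₂_same.2 fun _ _ => .refl, .inl ha⟩
  | head hstep hrest ih =>
    cases hstep with
    | @root l r σ hlr =>
      exact ⟨ts, List.forall₂_same.2 fun _ _ => .refl,
        .inr ⟨_, ⟨l, r, σ, hlr, ha.symm, rfl⟩, hrest⟩⟩
    | @congr s t g pre post hst =>
      cases ha
      obtain ⟨us, hus, h⟩ := ih rfl
      exact ⟨us, forall₂_head hst hus, h⟩

theorem forall₂_mono_of_mem {α β : Type*} {r r' : α → β → Prop} {l : List α} {m : List β}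
    (h : List.Forall₂ r l m) (hr : ∀ a ∈ l, ∀ b ∈ m, r a b → r' a b) : List.Forall₂ r' l m := by
  induction h with
  | nil => exact .nil
  | cons hab _ ih =>
    exact .cons (hr _ (.head _) _ (.head _) hab)
      (ih fun a ha b hb => hr a (.tail _ ha) b (.tail _ hb))

theorem irews_of_forall₂ {r' : Term F V → Term F V → Prop} {f : F}
    (hr' : ∀ {s t : Term F V} {ts us : List (Term F V)}, IRew R s t →
      r' (.app f (ts ++ s :: us)) (.app f (ts ++ t :: us)))
    {ts us : List (Term F V)} (h : List.Forall₂ (Reds R) ts us)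
    (hus : ∀ u ∈ us, NormalForm R u)
    (hts : ∀ t ∈ ts, ∀ w, NormalForm R w → Reds R t w → ReflTransGen (IRew R) t w) :
    ReflTransGen r' (.app f ts) (.app f us) :=
  reflTransGen_app_of_forall₂ hr'
    (forall₂_mono_of_mem h fun a ha b hb => hts a ha b (hus b hb))

theorem transGen_lower {t a b : Term F V} (h : Reds R t a) (hab : Rew R a b) :
    TransGen (Lower R) b t := by
  induction h using ReflTransGen.head_induction_on with
  | refl => exact .single (.inl hab)
  | head hstep _ ih => exact .tail ih (.inl hstep)

/-- Innermost rewriting finds all normal forms of terminating terms. -/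
theorem innermost_reds (hR : RightLinear R) (hov : ∀ p ∈ R, NoInnerOverlap R p.1)
    (hlhs : ∀ p ∈ R, ¬ p.1.IsVar) {t : Term F V} (ht : Acc (Lower R) t) {w : Term F V}
    (hw : NormalForm R w) (htw : Reds R t w) : ReflTransGen (IRew R) t w := by
  have ht' := ht.transGen
  induction ht' generalizing w with
  | intro t _ ih =>
    cases t with
    | var x =>
      rcases htw.cases_head with rfl | ⟨v, hv, -⟩
      · exact .refl
      · generalize ha : (Term.var x : Term F V) = a at hv
        cases hv with
        | @root l r σ hlr =>
          have := hlhs _ hlr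
          cases l <;> simp_all [Term.IsVar]
        | congr => cases ha
    | app f ts =>
      have hts : ∀ t ∈ ts, ∀ w, NormalForm R w → Reds R t w → ReflTransGen (IRew R) t w :=
        fun t h w hw htw => ih t (.single (.inr (.head h))) (ht.inv (.inr (.head h))) hw htw
      obtain ⟨us, hus, rfl | ⟨b, ⟨l, r, σ, hlr, hl, rfl⟩, hbw⟩⟩ := app_reds_cases htw rfl
      · exact irews_of_forall₂ .congr hus (fun u hu => hw.of_psub (.head hu)) hts
      have hlv := hlhs _ hlr
      cases l with
      | var x => exact absurd trivial hlv
      | app g ls =>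
        rw [Term.subst_app] at hl
        cases hl
        have hacc := acc_lower_of_reds ht (reds_app hus)
        have hσ : ∀ x ∈ (Term.app f ls).varOccs, Acc (Lower R) (σ x) := fun x hx =>
          hacc.inv (.inr (by simpa using psub_subst_of_mem hx hlv σ))
        obtain ⟨τ, h1, h2, -, h4⟩ := exists_normal_subst (Q := fun t => Reds R t w) (nh := False)
          (D := .hole) (hR _ hlr) False.elim (Term.app f ls).varOccs
          (fun x hx => exists_normalForm (hσ x hx))
          (fun x hx => normalizable_reds hR hov hw (hσ x hx)) hbw
        have hnf : ∀ u, PSub u ((Term.app f ls).subst τ) → NormalForm R u := fun u hu =>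
          normalForm_args (hov _ hlr) hlv h2 hu
        have hred : List.Forall₂ (Reds R) ts (ls.map (Term.subst τ)) := by
          refine forall₂_reds_trans hus ?_
          exact forall₂_map_subst fun t _ => reds_subst h1 t
        have hroot : IRew R ((Term.app f ls).subst τ) (r.subst τ) := .root hlr hnf
        rw [Term.subst_app] at hroot hnf
        have hstep : Rew R (.app f (ls.map (Term.subst τ))) (r.subst τ) := by
          simpa using Rew.root (σ := τ) hlr
        exact .trans (irews_of_forall₂ .congr hred (fun u hu => hnf u (.head hu)) hts)
          (.head hroot (ih _ (transGen_lower (reds_app hred) hstep)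
            ((acc_lower_of_reds ht (reds_app hred)).inv (.inl hstep)) hw h4))

section Chains

variable {P : Set (Term F V × Term F V)} {M : Term F V → Prop}

/-- `t` starts an infinite chain whose terms satisfy `M`. -/
def StartsChain (P R : Set (Term F V × Term F V)) (M : Term F V → Prop) (t : Term F V) : Prop :=
  ∃ S : Set (Term F V), t ∈ S ∧
    ∀ a ∈ S, M a ∧ ∃ s b, Reds R a s ∧ RootStep P s b ∧ b ∈ S

theorem StartsChain.unfold {t : Term F V} (h : StartsChain P R M t) :
    M t ∧ ∃ s b, Reds R t s ∧ RootStep P s b ∧ StartsChain P R M b := by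
  obtain ⟨S, ht, hS⟩ := h
  obtain ⟨hM, s, b, h1, h2, h3⟩ := hS t ht
  exact ⟨hM, s, b, h1, h2, S, h3, hS⟩

theorem StartsChain.of_step {t s b : Term F V} (hM : M t) (hts : Reds R t s)
    (hsb : RootStep P s b) (hb : StartsChain P R M b) : StartsChain P R M t := by
  obtain ⟨S, hbS, hS⟩ := hb
  refine ⟨insert t S, .inl rfl, ?_⟩
  rintro a (rfl | ha)
  · exact ⟨hM, s, b, hts, hsb, .inr hbS⟩
  · obtain ⟨hM, s, b, h1, h2, h3⟩ := hS a ha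
    exact ⟨hM, s, b, h1, h2, .inr h3⟩

theorem StartsChain.of_reds {t u : Term F V} (hM : M t) (htu : Reds R t u)
    (hu : StartsChain P R M u) : StartsChain P R M t := by
  obtain ⟨-, s, b, h1, h2, h3⟩ := hu.unfold
  exact .of_step hM (htu.trans h1) h2 h3

theorem normalizable_startsChain (hR : RightLinear R) (hP : RightLinear P)
    (hPnv : NonCollapsing P)
    (hovR : ∀ p ∈ R, NoInnerOverlap R p.1) (hovP : ∀ p ∈ P, NoInnerOverlap R p.1)
    (hM : ∀ a b, M a → Reds R a b → M b) (hMroot : ∀ a b, M a → ¬ RootStep R a b)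
    {u : Term F V} (hu : Acc (Lower R) u) :
    Normalizable R (StartsChain P R M) True u := by
  induction hu with
  | intro u hacc ih =>
    intro C hC hchain
    by_contra hcon
    obtain ⟨u₀, hu₀, hu₀n⟩ := exists_normalForm ⟨u, hacc⟩
    let Bad : Ctx F V → Prop := fun D => D ≠ .hole ∧ StartsChain P R M (D.fill u) ∧
      ∀ v, Reds R u v → NormalForm R v → ¬ StartsChain P R M (D.fill v)
    have hbad : Bad C := ⟨hC trivial, hchain, fun v h1 h2 h3 => hcon ⟨v, h1, h2, h3⟩⟩
    let S : Set (Term F V) := {a | StartsChain P R M a ∨ ∃ D, Bad D ∧ a = D.fill u₀}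
    have hMfill : ∀ {D}, Bad D → ∀ {v}, Reds R u v → M (D.fill v) := fun hD _ hv =>
      hM _ _ hD.2.1.unfold.1 (reds_fill hv _)
    have key : ∀ {a s b}, Reds R a s → RootStep P s b → StartsChain P R M b →
        ∀ D, Bad D → a = D.fill u → ∃ s' b', Reds R (D.fill u₀) s' ∧ RootStep P s' b' ∧ b' ∈ S := by
      intro a s b has hsb hb
      induction has using ReflTransGen.head_induction_on with
      | refl =>
        intro D hD ha
        obtain ⟨l, r, σ, hlr, rfl, rfl⟩ := hsb
        have hrv : ¬ r.IsVar := hPnv _ hlr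
        have hstep : ∀ τ : V → Term F V, RootStep P (l.subst τ) (r.subst τ) := fun τ =>
          ⟨l, r, τ, hlr, rfl, rfl⟩
        rcases root_contraction_cases (R := R) hD.1 (hP _ hlr) ha with
          h | ⟨E, hE, hbE, h⟩ | ⟨p, hp, hpv, rfl, h⟩
        · obtain ⟨τ, h1, h2⟩ := h u₀ hu₀
          exact ⟨_, _, h1, hstep τ, .inl (h2 ▸ hb)⟩
        · obtain ⟨τ, h1, h2⟩ := h u₀ hu₀
          refine ⟨_, _, h1, hstep τ, .inr ⟨E, ⟨hE hrv, hbE ▸ hb, fun v hv hvn hc => ?_⟩, h2.symm⟩⟩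
          obtain ⟨τ', h1', h2'⟩ := h v hv
          exact hD.2.2 v hv hvn (.of_step (hMfill hD hv) h1' (hstep τ') (h2' ▸ hc))
        · obtain ⟨τ, h1, h2, h3, h4⟩ := exists_normalForm_of_overlap (D := .hole) (hP _ hlr)
            (hovP _ hlr) hp hpv (fun _ => .inr hrv) ⟨_, hacc⟩ ih hb
          exact absurd (.of_step (hMfill hD h2) (h τ h1) (hstep τ) h4) (hD.2.2 _ h2 h3)
      | @head a a' hstep hrest ihs =>
        intro D hD ha
        have hMa : M a := ha ▸ hD.2.1.unfold.1
        have ha' : StartsChain P R M a' :=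
          .of_step (hM _ _ hMa (.single hstep)) hrest hsb hb
        rcases rew_fill_cases hR hstep ha with ⟨v, hv, rfl⟩ | h | ⟨E, hE, rfl, h⟩ |
          ⟨l, r, p, σ, E, hlr, hp, hpv, rfl, hE, rfl, h⟩
        · obtain ⟨v', h1, h2, h3⟩ := ih v (.inl hv) D (fun _ => hD.1) ha'
          exact absurd h3 (hD.2.2 v' (.head hv h1) h2)
        · exact ⟨s, b, (h u₀ hu₀).trans hrest, hsb, .inl hb⟩
        · have hEbad : Bad E := ⟨hE hD.1 (hMroot _ _ hMa), ha', fun v hv hvn hc =>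
            hD.2.2 v hv hvn (.of_reds (hMfill hD hv) (h v hv) hc)⟩
          obtain ⟨s', b', h1, h2, h3⟩ := ihs E hEbad rfl
          exact ⟨s', b', (h u₀ hu₀).trans h1, h2, h3⟩
        · obtain ⟨τ, h1, h2, h3, h4⟩ := exists_normalForm_of_overlap (hR _ hlr)
            (hovR _ hlr) hp hpv (fun _ => .inl (hE hD.1 (hMroot _ _ hMa))) ⟨_, hacc⟩ ih ha'
          exact absurd (.of_reds (hMfill hD h2) (h τ h1) h4) (hD.2.2 _ h2 h3)
    refine hbad.2.2 u₀ hu₀ hu₀n ⟨S, .inr ⟨C, hbad, rfl⟩, ?_⟩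
    rintro a (ha | ⟨D, hD, rfl⟩)
    · obtain ⟨hMa, s, b, h1, h2, h3⟩ := ha.unfold
      exact ⟨hMa, s, b, h1, h2, .inl h3⟩
    · obtain ⟨-, s, b, h1, h2, h3⟩ := hD.2.1.unfold
      exact ⟨hMfill hD hu₀, key h1 h2 h3 D hD rfl⟩

theorem exists_innermost_step (hR : RightLinear R) (hP : RightLinear P) (hPnv : NonCollapsing P)
    (hovR : ∀ p ∈ R, NoInnerOverlap R p.1) (hovP : ∀ p ∈ P, NoInnerOverlap R p.1)
    (hlhsR : ∀ p ∈ R, ¬ p.1.IsVar) (hlhsP : ∀ p ∈ P, ¬ p.1.IsVar)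
    (hM : ∀ a b, M a → Reds R a b → M b) (hMroot : ∀ a b, M a → ¬ RootStep R a b)
    (hMvar : ∀ a, M a → ¬ a.IsVar) (hMargs : ∀ a v, M a → PSub v a → Acc (Lower R) v)
    {t : Term F V} (ht : StartsChain P R M t) :
    ∃ s b, ReflTransGen (IBelowRew R) t s ∧ (∀ v, PSub v s → NormalForm R v) ∧
      RootStep P s b ∧ StartsChain P R M b := by
  obtain ⟨hMt, _, _, hts, ⟨l, r, σ, hlr, rfl, rfl⟩, hb⟩ := ht.unfold
  have hlv := hlhsP _ hlr
  have hσ : ∀ x ∈ l.varOccs, Acc (Lower R) (σ x) := fun x hx =>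
    hMargs _ _ (hM _ _ hMt hts) (psub_subst_of_mem hx hlv σ)
  obtain ⟨τ, h1, h2, -, h4⟩ := exists_normal_subst (Q := StartsChain P R M) (nh := True)
    (D := .hole) (hP _ hlr) (fun _ => .inr (hPnv _ hlr)) l.varOccs
    (fun x hx => exists_normalForm (hσ x hx))
    (fun x hx => normalizable_startsChain hR hP hPnv hovR hovP hM hMroot (hσ x hx)) hb
  have hnf : ∀ u, PSub u (l.subst τ) → NormalForm R u := fun u hu =>
    normalForm_args (hovP _ hlr) hlv h2 hu
  refine ⟨l.subst τ, r.subst τ, ?_, hnf, ⟨l, r, τ, hlr, rfl, rfl⟩, h4⟩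
  cases t with
  | var x => exact absurd trivial (hMvar _ hMt)
  | app f ts =>
    obtain ⟨us, hus, h | ⟨b, hb, -⟩⟩ := app_reds_cases (hts.trans (reds_subst h1 l)) rfl
    · rw [h] at hnf ⊢
      exact irews_of_forall₂ (fun h => ⟨_, _, _, _, _, h, rfl, rfl⟩) hus
        (fun u hu => hnf u (.head hu))
        fun t ht w => innermost_reds hR hovR hlhsR (hMargs _ _ hMt (.head ht))
    · exact absurd hb (hMroot _ _ (hM _ _ hMt (reds_app hus)))

end Chains

theorem IRew.rew {s t : Term F V} (h : IRew R s t) : Rew R s t := by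
  induction h with
  | root h _ => exact .root h
  | congr _ ih => exact .congr ih

theorem IBelowRew.belowRew {s t : Term F V} (h : IBelowRew R s t) : BelowRew R s t := by
  obtain ⟨f, ts, us, a, b, h, h'⟩ := h
  exact ⟨f, ts, us, a, b, h.rew, h'⟩

theorem BelowRew.rew {s t : Term F V} (h : BelowRew R s t) : Rew R s t := by
  obtain ⟨f, ts, us, a, b, h, rfl, rfl⟩ := h
  exact .congr h

theorem InfInnMinChain.infMinChain {P : Set (Term F V × Term F V)} (h : InfInnMinChain P R) :
    InfMinChain P R := by
  obtain ⟨t, s, h1, -, h3, h4⟩ := h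
  exact ⟨t, s, fun i => ReflTransGen.mono (fun _ _ => IBelowRew.belowRew) _ _ (h1 i), h3, h4⟩

/-- The root of the term is a tuple symbol. -/
def TupleRooted (t : Term (F ⊕ F) V) : Prop := ∃ g ts, t = .app (Sum.inr g) ts

theorem tupleRooted_sharp {t : Term F V} (h : ¬ t.IsVar) : TupleRooted t.sharp := by
  cases t with
  | var x => exact absurd trivial h
  | app f ts => exact ⟨f, _, rfl⟩

theorem TupleRooted.not_isVar {t : Term (F ⊕ F) V} (h : TupleRooted t) : ¬ t.IsVar := by
  obtain ⟨g, ts, rfl⟩ := h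
  exact id

theorem TupleRooted.subst {t : Term (F ⊕ F) V} (h : TupleRooted t) (σ : V → Term (F ⊕ F) V) :
    TupleRooted (t.subst σ) := by
  obtain ⟨g, ts, rfl⟩ := h
  exact ⟨g, _, Term.subst_app _ _ _⟩

theorem not_isVar_of_mem_liftTRS (hTRS : IsTRS R) : ∀ p ∈ liftTRS R, ¬ p.1.IsVar := by
  rintro _ ⟨l, r, hlr, rfl⟩
  have := (hTRS _ hlr).1
  cases l with
  | var x => exact absurd trivial this
  | app f ts => rw [Term.lift]; exact id

theorem TupleRooted.not_rootStep (hTRS : IsTRS R) {a b : Term (F ⊕ F) V} (ha : TupleRooted a) :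
    ¬ RootStep (liftTRS R) a b := by
  rintro ⟨_, _, σ, ⟨l, r, hlr, heq⟩, rfl, rfl⟩
  obtain ⟨rfl, rfl⟩ := Prod.mk.inj heq
  obtain ⟨g, ts, h⟩ := ha
  have := (hTRS _ hlr).1
  cases l with
  | var x => exact absurd trivial this
  | app f ls => rw [Term.lift, Term.subst_app] at h; cases h

/-- Tuple-rooted terms all of whose proper subterms are terminating. -/
def ChainTerm (R : Set (Term F V × Term F V)) (t : Term (F ⊕ F) V) : Prop :=
  TupleRooted t ∧ ∀ v, PSub v t → Acc (Lower (liftTRS R)) v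

theorem ChainTerm.of_rew (hTRS : IsTRS R) {a b : Term (F ⊕ F) V} (ha : ChainTerm R a)
    (h : Rew (liftTRS R) a b) : ChainTerm R b := by
  cases h with
  | @root l r σ hlr =>
    exact absurd ⟨l, r, σ, hlr, rfl, rfl⟩ (ha.1.not_rootStep hTRS (b := r.subst σ))
  | @congr s t f ts us hst =>
    obtain ⟨⟨g, _, h⟩, hacc⟩ := ha
    cases h
    refine ⟨⟨g, _, rfl⟩, fun v hv => ?_⟩
    obtain ⟨w, hw, hvw⟩ := psub_app_iff.1 hv
    refine acc_lower_of_sub ?_ hvw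
    rcases List.mem_append.1 hw with hw | hw
    · exact hacc _ (.head (by simp [hw]))
    · rcases List.mem_cons.1 hw with rfl | hw
      · exact (hacc s (.head (by simp))).inv (.inl hst)
      · exact hacc _ (.head (by simp [hw]))

theorem ChainTerm.of_reds (hTRS : IsTRS R) {a b : Term (F ⊕ F) V} (ha : ChainTerm R a)
    (h : Reds (liftTRS R) a b) : ChainTerm R b := by
  induction h with
  | refl => exact ha
  | tail _ h ih => exact ih.of_rew hTRS h

theorem tupleRooted_of_belowReds {S : Set (Term (F ⊕ F) V × Term (F ⊕ F) V)}
    {a b : Term (F ⊕ F) V} (h : ReflTransGen (BelowRew S) a b) (hb : TupleRooted b) :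
    TupleRooted a := by
  induction h using ReflTransGen.head_induction_on with
  | refl => exact hb
  | head h _ ih =>
    obtain ⟨f, ts, us, a, b, -, rfl, rfl⟩ := h
    obtain ⟨g, _, h⟩ := ih
    cases h
    exact ⟨g, _, rfl⟩

theorem tupleRooted_of_mem_DP (hTRS : IsTRS R) {p : Term (F ⊕ F) V × Term (F ⊕ F) V}
    (hp : p ∈ DP R) : TupleRooted p.1 ∧ TupleRooted p.2 := by
  obtain ⟨l, r, t, hlr, -, ⟨g, ts, rfl, -⟩, rfl⟩ := hp
  exact ⟨tupleRooted_sharp (hTRS _ hlr).1, tupleRooted_sharp (t := .app g ts) id⟩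

theorem Overlay.noInnerOverlap {R S : Set (Term F V × Term F V)} (h : Overlay S) (hRS : R ⊆ S) :
    ∀ p ∈ S, NoInnerOverlap R p.1 :=
  fun p hp q hq hqv l' r' σ τ hlr heq =>
    h ⟨p.1, p.2, l', r', q, hp, hRS hlr, hq, hqv, σ, τ, heq⟩

theorem InfMinChain.infInnMinChain (hTRS : IsTRS R)
    {P : Set (Term (F ⊕ F) V × Term (F ⊕ F) V)} (hP : P ⊆ DP R)
    (hRL : RightLinear (liftTRS R ∪ P)) (hOV : Overlay (liftTRS R ∪ P))
    (h : InfMinChain P (liftTRS R)) : InfInnMinChain P (liftTRS R) := by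
  obtain ⟨t, s, hts, hst, hmin⟩ := h
  have hroot : ∀ i, TupleRooted (t i) := fun i => by
    refine tupleRooted_of_belowReds (hts i) ?_
    obtain ⟨l, r, σ, hlr, hl, -⟩ := hst i
    exact hl ▸ (tupleRooted_of_mem_DP hTRS (hP hlr)).1.subst σ
  have hstart : StartsChain P (liftTRS R) (ChainTerm R) (t 0) := by
    refine ⟨Set.range t, ⟨0, rfl⟩, ?_⟩
    rintro _ ⟨i, rfl⟩
    exact ⟨⟨hroot i, fun v hv => terminating_iff_acc.1 (hmin i v hv)⟩, s i, t (i + 1),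
      ReflTransGen.mono (fun _ _ => BelowRew.rew) _ _ (hts i), hst i, i + 1, rfl⟩
  have hov := hOV.noInnerOverlap Set.subset_union_left
  have hstep : ∀ a : {a // StartsChain P (liftTRS R) (ChainTerm R) a}, ∃ s,
      ∃ b : {a // StartsChain P (liftTRS R) (ChainTerm R) a},
        ReflTransGen (IBelowRew (liftTRS R)) a.1 s ∧
        (∀ v, PSub v s → NormalForm (liftTRS R) v) ∧ RootStep P s b.1 := by
    rintro ⟨a, ha⟩
    obtain ⟨s, b, h1, h2, h3, h4⟩ := exists_innermost_step
      (fun p hp => hRL p (.inl hp)) (fun p hp => hRL p (.inr hp))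
      (fun p hp => (tupleRooted_of_mem_DP hTRS (hP hp)).2.not_isVar)
      (fun p hp => hov p (.inl hp)) (fun p hp => hov p (.inr hp))
      (not_isVar_of_mem_liftTRS hTRS)
      (fun p hp => (tupleRooted_of_mem_DP hTRS (hP hp)).1.not_isVar)
      (fun _ _ ha h => ha.of_reds hTRS h) (fun _ _ ha => ha.1.not_rootStep hTRS)
      (fun _ ha => ha.1.not_isVar) (fun _ v ha hv => ha.2 v hv) ha
    exact ⟨s, ⟨b, h4⟩, h1, h2, h3⟩
  choose s' next h1 h2 h3 using hstep
  let u : ℕ → {a // StartsChain P (liftTRS R) (ChainTerm R) a} := fun n =>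
    next^[n] ⟨t 0, hstart⟩
  have hu : ∀ n, u (n + 1) = next (u n) := fun n => iterate_succ_apply' _ _ _
  refine ⟨fun n => (u n).1, fun n => s' (u n), fun n => h1 _, fun n => h2 _, fun n => ?_,
    fun n v hv => terminating_iff_acc.2 ((u n).2.unfold.1.2 v hv)⟩
  change RootStep P (s' (u n)) (u (n + 1)).1
  rw [hu]
  exact h3 _

end RWS

namespace RWS

/-- Let `R` be a TRS and `P ⊆ DP(R)` such that `R ∪ P` is a
right-linear overlay system. Then there is no infinite minimal `(P,R)`-chain
iff there is no infinite innermost minimal `(P,R)`-chain. -/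
theorem no_infinite_minimal_DP_chain_iff_innermost
    {F V : Type} (R : Set (Term F V × Term F V)) (hTRS : IsTRS R)
    (P : Set (Term (F ⊕ F) V × Term (F ⊕ F) V)) (hP : P ⊆ DP R)
    (hRL : RightLinear (liftTRS R ∪ P)) (hOV : Overlay (liftTRS R ∪ P)) :
    ¬ InfMinChain P (liftTRS R) ↔ ¬ InfInnMinChain P (liftTRS R) := by
  exact not_congr ⟨InfMinChain.infInnMinChain hTRS hP hRL hOV, InfInnMinChain.infMinChain⟩

end RWS
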